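/- arXiv:2603.14735 — 3 statements merged into one kernel-verified Lean document; each statement's English description precedes it below -/
import Mathlib

section
/- Let (L, ∘_λ, [·_λ·]) be a transposed Poisson conformal algebra. Then for all x, y, z ∈ L the identity x∘_λ[y_μ z] + y∘_μ[z_{−∂−λ} x] + z∘_{−∂−λ−μ}[x_λ y] = 0 holds (as an identity of polynomials in λ, μ with coefficients in L, where substitutions of the λ-variable by expressions involving ∂ are interpreted via the ℂ[∂]-module action). -/
/-!
We model a `ℂ[∂]`-module as a complex vector space `L` together with an
endomorphism `D` (the action of `∂`).  A `λ`-product (or `λ`-bracket) is a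
`ℂ`-bilinear map `L → L → L[λ]`, where the polynomial `x ∘_λ y = Σₙ λⁿ • cₙ`
is encoded by its finitely supported family of coefficients `ℕ →₀ L`.
Substitution of the variable `λ` by a complex scalar, or by an operator such
as `-∂-λ`, is given by `ev`; since `ℂ` is infinite, an identity of
polynomials in (several) variables `λ, μ, γ` with coefficients in a complex
vector space holds formally if and only if it holds for all complex values
of the variables, which is how all identities are stated below.
-/

namespace ConfFormal

variable {L : Type*} [AddCommGroup L] [Module ℂ L]

/-- Evaluation of a polynomial `p = Σₙ λⁿ • pₙ` with coefficients in `L`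
(encoded as the family of its coefficients) at an endomorphism `T` of `L`
(for instance at a scalar `λ`, or at an operator such as `-∂-λ`). -/
noncomputable def ev (T : Module.End ℂ L) (p : ℕ →₀ L) : L :=
  p.sum fun n x => (T ^ n) x

/-- `app m T x y` is `x ∘_T y` : the `λ`-product `x ∘_λ y` recorded by the
`ℂ`-bilinear coefficient map `m`, with the variable `λ` substituted by the
endomorphism `T`. -/
noncomputable def app (m : L →ₗ[ℂ] L →ₗ[ℂ] (ℕ →₀ L)) (T : Module.End ℂ L) (x y : L) : L :=
  ev T (m x y)

/-- The scalar `c` viewed as an endomorphism of `L`. -/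
noncomputable def sc (c : ℂ) : Module.End ℂ L := c • (1 : Module.End ℂ L)

/-- `(L, D, m)` is a conformal algebra: conformal sesquilinearity holds. -/
structure IsConfAlg (D : Module.End ℂ L) (m : L →ₗ[ℂ] L →ₗ[ℂ] (ℕ →₀ L)) : Prop where
  sesq_left : ∀ (x y : L) (l : ℂ), app m (sc l) (D x) y = -l • app m (sc l) x y
  sesq_right : ∀ (x y : L) (l : ℂ),
    app m (sc l) x (D y) = D (app m (sc l) x y) + l • app m (sc l) x y

/-- `(L, D, m)` is a commutative associative conformal algebra. -/
structure IsCommAssocConfAlg (D : Module.End ℂ L) (m : L →ₗ[ℂ] L →ₗ[ℂ] (ℕ →₀ L))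
    extends IsConfAlg D m : Prop where
  assoc : ∀ (x y z : L) (l u : ℂ),
    app m (sc l) x (app m (sc u) y z) = app m (sc (l + u)) (app m (sc l) x y) z
  comm : ∀ (x y : L) (l : ℂ), app m (sc l) x y = app m (-(D + sc l)) y x

/-- `(L, D, br)` is a Lie conformal algebra. -/
structure IsLieConfAlg (D : Module.End ℂ L) (br : L →ₗ[ℂ] L →ₗ[ℂ] (ℕ →₀ L)) : Prop where
  sesq_left : ∀ (x y : L) (l : ℂ), app br (sc l) (D x) y = -l • app br (sc l) x y
  skew : ∀ (x y : L) (l : ℂ), app br (sc l) x y = -app br (-(sc l + D)) y x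
  jacobi : ∀ (x y z : L) (l u : ℂ),
    app br (sc l) x (app br (sc u) y z) =
      app br (sc (l + u)) (app br (sc l) x y) z + app br (sc u) y (app br (sc l) x z)

/-- `(L, D, m, br)` is a transposed Poisson conformal algebra. -/
structure IsTPCA (D : Module.End ℂ L) (m br : L →ₗ[ℂ] L →ₗ[ℂ] (ℕ →₀ L)) : Prop where
  commAssoc : IsCommAssocConfAlg D m
  lie : IsLieConfAlg D br
  tLeibniz : ∀ (x y z : L) (l u : ℂ),
    (2 : ℂ) • app m (sc l) x (app br (sc u) y z) =
      app br (sc (l + u)) (app m (sc l) x y) z + app br (sc u) y (app m (sc l) x z)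


theorem sc_apply (c : ℂ) (x : L) : sc c x = c • x := by
  simp [sc]

theorem sc_pow_apply (c : ℂ) (n : ℕ) (x : L) : (sc c ^ n) x = c ^ n • x := by
  simp [sc, smul_pow]

/-- `ev T` as a function of the endomorphism `T`, linear in the polynomial. -/
noncomputable def evFun : (ℕ →₀ L) →ₗ[ℂ] (Module.End ℂ L → L) where
  toFun p T := ev T p
  map_add' p q := by
    funext T
    exact Finsupp.sum_add_index' (by simp) (by simp)
  map_smul' c p := by
    funext T
    simp only [ev, Pi.smul_apply, RingHom.id_apply]
    rw [Finsupp.sum_smul_index' (by simp), Finsupp.smul_sum]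
    simp

theorem ev_single (T : Module.End ℂ L) (n : ℕ) (x : L) :
    ev T (Finsupp.single n x) = (T ^ n) x := by
  simp [ev]

/-- `m` with its variable substituted by `T`, as a bilinear map. -/
noncomputable def appLin (m : L →ₗ[ℂ] L →ₗ[ℂ] (ℕ →₀ L)) (T : Module.End ℂ L) :
    L →ₗ[ℂ] L →ₗ[ℂ] L :=
  m.compr₂ ((LinearMap.proj T).comp evFun)

theorem appLin_apply (m : L →ₗ[ℂ] L →ₗ[ℂ] (ℕ →₀ L)) (T : Module.End ℂ L) (x y : L) :
    appLin m T x y = app m T x y := rfl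

theorem map_ev {B S T : Module.End ℂ L} (hB : B * S = T * B) (p : ℕ →₀ L) :
    B (ev S p) = p.sum fun n x => (T ^ n) (B x) := by
  simp only [ev, map_finsuppSum]
  refine Finsupp.sum_congr fun n _ => ?_
  have h : SemiconjBy B S T := hB
  exact LinearMap.congr_fun (h.pow_right n) (p n)

/-- A polynomial with coefficients in `L` vanishing at all scalars is zero. -/
theorem eq_zero_of_ev_sc_eq_zero {p : ℕ →₀ L} (h : ∀ c, ev (sc c) p = 0) : p = 0 := by
  ext n
  rw [Finsupp.zero_apply, ← Module.forall_dual_apply_eq_zero_iff ℂ]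
  intro f
  have hP : (∑ k ∈ p.support, Polynomial.monomial k (f (p k))) = 0 := by
    refine Polynomial.funext fun c => ?_
    have hc := congrArg f (h c)
    simp only [ev, Finsupp.sum, sc_pow_apply, map_sum, map_smul, smul_eq_mul, map_zero] at hc
    simp only [Polynomial.eval_finsetSum, Polynomial.eval_monomial, Polynomial.eval_zero]
    rw [← hc]
    exact Finset.sum_congr rfl fun k _ => mul_comm _ _
  have hn := congrArg (fun P => Polynomial.coeff P n) hP
  by_cases hp : p n = 0
  · simp [hp]
  · simpa [Polynomial.finsetSum_coeff, Polynomial.coeff_monomial, hp] using hn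

/-- Functions `T ↦ ∑ Tⁿ pₙ` of an endomorphism `T`, for polynomials `p` with coefficients
in `L`. -/
noncomputable def polyFun (L : Type*) [AddCommGroup L] [Module ℂ L] :
    Submodule ℂ (Module.End ℂ L → L) :=
  LinearMap.range evFun

theorem ev_mem_polyFun (p : ℕ →₀ L) : (fun T => ev T p) ∈ polyFun L := ⟨p, rfl⟩

theorem apply_mem_polyFun {F : Module.End ℂ L → L} (hF : F ∈ polyFun L) :
    (fun T => T (F T)) ∈ polyFun L := by
  obtain ⟨p, rfl⟩ := hF
  induction p using Finsupp.induction_linear with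
  | zero =>
    convert (polyFun L).zero_mem using 1
    funext T
    simp
  | add p q hp hq =>
    convert (polyFun L).add_mem hp hq using 1
    funext T
    simp
  | single n x =>
    refine ⟨Finsupp.single (n + 1) x, ?_⟩
    funext T
    change ev T _ = T (ev T _)
    rw [ev_single, ev_single, pow_succ', Module.End.mul_apply]

theorem pow_apply_mem_polyFun {F : Module.End ℂ L → L} (hF : F ∈ polyFun L) (n : ℕ) :
    (fun T => (T ^ n) (F T)) ∈ polyFun L := by
  induction n with
  | zero => simpa using hF
  | succ n ih => simpa [pow_succ'] using apply_mem_polyFun ih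

theorem ev_sc_add_mem_polyFun (a : ℂ) (p : ℕ →₀ L) :
    (fun T => ev (sc a + T) p) ∈ polyFun L := by
  induction p using Finsupp.induction_linear with
  | zero =>
    convert (polyFun L).zero_mem using 1
    funext T
    simp [ev]
  | add p q hp hq =>
    convert (polyFun L).add_mem hp hq using 1
    funext T
    exact congrFun (map_add evFun p q) (sc a + T)
  | single n x =>
    simp only [ev_single]
    induction n with
    | zero => simpa [ev_single] using ev_mem_polyFun (Finsupp.single 0 x)
    | succ n ih =>
      convert (polyFun L).add_mem ((polyFun L).smul_mem a ih) (apply_mem_polyFun ih) using 1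
      funext T
      simp [pow_succ', sc_apply]

/-- A polynomial identity valid at all scalars is valid at all endomorphisms. -/
theorem polyFun_ext {F G : Module.End ℂ L → L} (hF : F ∈ polyFun L) (hG : G ∈ polyFun L)
    (h : ∀ c, F (sc c) = G (sc c)) : F = G := by
  obtain ⟨p, rfl⟩ := hF
  obtain ⟨q, rfl⟩ := hG
  have : p - q = 0 := eq_zero_of_ev_sc_eq_zero fun c => by
    have := congrFun (map_sub evFun p q) (sc c)
    exact this.trans (sub_eq_zero.mpr (h c))
  rw [sub_eq_zero.mp this]

theorem IsLieConfAlg.sesq_right {D : Module.End ℂ L} {br : L →ₗ[ℂ] L →ₗ[ℂ] (ℕ →₀ L)}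
    (h : IsLieConfAlg D br) (x y : L) (l : ℂ) :
    app br (sc l) x (D y) = D (app br (sc l) x y) + l • app br (sc l) x y := by
  have key : (fun T => app br T (D y) x) = -fun T => T (app br T y x) := by
    refine polyFun_ext (ev_mem_polyFun _)
      ((polyFun L).neg_mem (apply_mem_polyFun (ev_mem_polyFun _))) fun c => ?_
    simp [h.sesq_left, sc_apply]
  rw [h.skew x (D y), h.skew x y, congrFun key]
  simp only [Pi.neg_apply, LinearMap.neg_apply, LinearMap.add_apply, sc_apply, map_neg]
  module

/-- Conjugating the first factor of a bracket by commutativity of the product. -/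
theorem IsTPCA.bracket_comm {D : Module.End ℂ L} {m br : L →ₗ[ℂ] L →ₗ[ℂ] (ℕ →₀ L)}
    (h : IsTPCA D m br) (x y z : L) (l u : ℂ) :
    app br (sc (l + u)) (app m (sc u) y x) z = app br (sc (l + u)) (app m (sc l) x y) z := by
  rw [h.commAssoc.comm y x u]
  let B : Module.End ℂ L := (appLin br (sc (l + u))).flip z
  have h₁ : B * -(D + sc u) = sc l * B := by
    ext w
    simp only [B, Module.End.mul_apply, LinearMap.neg_apply, LinearMap.add_apply, map_neg, map_add,
      sc_apply, map_smul, LinearMap.flip_apply, appLin_apply, h.lie.sesq_left]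
    module
  have h₂ : B * sc l = sc l * B := by
    ext w
    simp [sc_apply]
  exact (map_ev h₁ (m x y)).trans (map_ev h₂ (m x y)).symm

theorem IsLieConfAlg.bracket_ev {D : Module.End ℂ L} {br : L →ₗ[ℂ] L →ₗ[ℂ] (ℕ →₀ L)}
    (h : IsLieConfAlg D br) (x : L) (l u : ℂ) (p : ℕ →₀ L) :
    app br (sc l) x (ev (-(D + sc u)) p) =
      p.sum fun n w => ((-(D + sc l + sc u) : Module.End ℂ L) ^ n) (app br (sc l) x w) := by
  refine map_ev (B := appLin br (sc l) x) ?_ p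
  ext w
  simp only [Module.End.mul_apply, LinearMap.neg_apply, LinearMap.add_apply, map_neg, map_add,
    sc_apply, map_smul, appLin_apply, h.sesq_right]

/-- The transposed Leibniz rule for `z ∘_{-∂-λ-μ} [x_λ y]`. -/
theorem IsTPCA.two_smul_app_bracket {D : Module.End ℂ L}
    {m br : L →ₗ[ℂ] L →ₗ[ℂ] (ℕ →₀ L)} (h : IsTPCA D m br) (x y z : L) (l u : ℂ) :
    (2 : ℂ) • app m (-(D + sc l + sc u)) z (app br (sc l) x y) =
      app br (sc l) x (app m (sc u) y z) - app br (sc u) y (app m (sc l) x z) := by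
  have key : ((2 : ℂ) • fun T => app m T z (app br (sc l) x y)) =
      (∑ n ∈ (m z x).support, fun T => (T ^ n) (app br (sc l + T) (m z x n) y)) +
        ∑ n ∈ (m z y).support, fun T => (T ^ n) (app br (sc l) x (m z y n)) := by
    refine polyFun_ext ((polyFun L).smul_mem _ (ev_mem_polyFun _))
      ((polyFun L).add_mem
        (sum_mem fun n _ => pow_apply_mem_polyFun (ev_sc_add_mem_polyFun l _) n)
        (sum_mem fun n _ => pow_apply_mem_polyFun
          (by simpa [ev_single] using ev_mem_polyFun (Finsupp.single 0 _)) n)) fun c => ?_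
    have hc (B : Module.End ℂ L) : B * sc c = sc c * B := by
      ext w
      simp [sc_apply]
    have hsc : sc l + sc c = (sc (c + l) : Module.End ℂ L) := by
      simp only [sc]
      module
    simp only [Pi.smul_apply, Pi.add_apply, Finset.sum_apply, hsc]
    rw [h.tLeibniz z x y c l]
    exact congrArg₂ (· + ·) (map_ev (hc ((appLin br (sc (c + l))).flip y)) (m z x))
      (map_ev (hc (appLin br (sc l) x)) (m z y))
  have hT : sc l + -(D + sc l + sc u) = -(sc u + D) := by abel
  have hT' : D + sc u + sc l = D + sc l + sc u := by abel
  have hkey := congrFun key (-(D + sc l + sc u))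
  simp only [Pi.smul_apply, Pi.add_apply, Finset.sum_apply, hT] at hkey
  rw [hkey, h.commAssoc.comm y z u, h.commAssoc.comm x z l]
  simp only [app.eq_1 m]
  rw [h.lie.bracket_ev x l u, h.lie.bracket_ev y u l, hT', sub_eq_neg_add]
  simp only [Finsupp.sum, ← Finset.sum_neg_distrib, h.lie.skew y, map_neg, neg_neg]

/-- In a transposed Poisson conformal algebra,
`x∘_λ[y_μ z] + y∘_μ[z_{−∂−λ} x] + z∘_{−∂−λ−μ}[x_λ y] = 0`. -/
theorem tpca_identity_eqh {L : Type*} [AddCommGroup L] [Module ℂ L]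
    (D : Module.End ℂ L) (m br : L →ₗ[ℂ] L →ₗ[ℂ] (ℕ →₀ L))
    (h : IsTPCA D m br) :
    ∀ (x y z : L) (l u : ℂ),
      app m (sc l) x (app br (sc u) y z)
        + app m (sc u) y (app br (-(D + sc l)) z x)
        + app m (-(D + sc l + sc u)) z (app br (sc l) x y) = 0 := by
  intro x y z l u
  have hskew : app br (-(D + sc l)) z x = -app br (sc l) x z := by
    rw [h.lie.skew x z l, neg_neg, add_comm]
  have hneg : app m (sc u) y (-app br (sc l) x z) = -app m (sc u) y (app br (sc l) x z) :=
    map_neg (appLin m (sc u) y) _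
  have hx := h.tLeibniz x y z l u
  have hy := h.tLeibniz y x z u l
  rw [add_comm u l, h.bracket_comm x y z l u] at hy
  have hz := h.two_smul_app_bracket x y z l u
  rw [hskew, hneg]
  refine (smul_eq_zero.mp ?_).resolve_left (two_ne_zero (α := ℂ))
  rw [smul_add, smul_add, smul_neg, hx, hy, hz]
  abel

end ConfFormal
end

section
/- Let (L, ∘_λ, [·_λ·]) be a transposed Poisson conformal algebra. Then for all x, y, z ∈ L the identity [x_λ y]∘_μ z + [y_{μ−λ} z]∘_{−∂−λ} x + [z_{−∂−λ} x]∘_{−∂−μ+λ} y = 0 holds (as an identity of polynomials in λ, μ with coefficients in L, where substitutions of the λ-variable by expressions involving ∂ are interpreted via the ℂ[∂]-module action). -/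
/-!
We model a `ℂ[∂]`-module as a complex vector space `L` together with an
endomorphism `D` (the action of `∂`).  A `λ`-product (or `λ`-bracket) is a
`ℂ`-bilinear map `L → L → L[λ]`, where the polynomial `x ∘_λ y = Σₙ λⁿ • cₙ`
is encoded by its finitely supported family of coefficients `ℕ →₀ L`.
Substitution of the variable `λ` by a complex scalar, or by an operator such
as `-∂-λ`, is given by `ev`; since `ℂ` is infinite, an identity of
polynomials in (several) variables `λ, μ, γ` with coefficients in a complex
vector space holds formally if and only if it holds for all complex values
of the variables, which is how all identities are stated below.
-/

namespace ConfFormal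

variable {L : Type*} [AddCommGroup L] [Module ℂ L]

/-- Evaluation at `T` as a linear map. -/
noncomputable def evLin (T : Module.End ℂ L) : (ℕ →₀ L) →ₗ[ℂ] L :=
  Finsupp.lsum ℂ fun n => T ^ n

theorem evLin_apply (T : Module.End ℂ L) (p : ℕ →₀ L) : evLin T p = ev T p := rfl

theorem map_ev_s1 {f S T : Module.End ℂ L} (hf : ∀ x, f (S x) = T (f x)) (p : ℕ →₀ L) :
    f (ev S p) = ev T (Finsupp.mapRange.linearMap f p) := by
  have hpow (n : ℕ) (x : L) : f ((S ^ n) x) = (T ^ n) (f x) := by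
    induction n generalizing x with
    | zero => simp
    | succ n ih => simp [pow_succ, ih, hf]
  unfold ev
  rw [map_finsuppSum, Finsupp.mapRange.linearMap_apply, Finsupp.sum_mapRange_index (by simp)]
  simp [hpow]

theorem map_ev_sc (f : Module.End ℂ L) (c : ℂ) (p : ℕ →₀ L) :
    f (ev (sc c) p) = ev (sc c) (Finsupp.mapRange.linearMap f p) :=
  map_ev_s1 (fun x => by simp [sc_apply]) p

theorem eq_zero_of_forall_ev_sc_eq_zero {p : ℕ →₀ L} (hp : ∀ c, ev (sc c) p = 0) : p = 0 := by
  ext n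
  rw [Finsupp.zero_apply, ← Module.forall_dual_apply_eq_zero_iff ℂ]
  intro f
  let q : Polynomial ℂ := p.sum fun n x => Polynomial.monomial n (f x)
  have hq : q = 0 := Polynomial.funext fun c => by
    have := congrArg f (hp c)
    simp only [ev, sc_pow_apply, map_finsuppSum, map_smul, map_zero, smul_eq_mul] at this
    simp only [q, Finsupp.sum, Polynomial.eval_finsetSum, Polynomial.eval_monomial,
      Polynomial.eval_zero]
    simpa [Finsupp.sum, mul_comm] using this
  have hn : q.coeff n = f (p n) := by
    simp only [q, Finsupp.sum, Polynomial.finsetSum_coeff, Polynomial.coeff_monomial]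
    simp +contextual
  rw [← hn, hq, Polynomial.coeff_zero]

/-- `F` is an `L`-valued polynomial function whose value after substituting `T` for the
variable is `v`. -/
def HasSubst (T : Module.End ℂ L) (F : ℂ → L) (v : L) : Prop :=
  ∃ p : ℕ →₀ L, (∀ c, F c = ev (sc c) p) ∧ v = ev T p

namespace HasSubst

variable {T : Module.End ℂ L} {F G : ℂ → L} {v w : L}

theorem unique (hF : HasSubst T F v) (hG : HasSubst T F w) : v = w := by
  obtain ⟨p, hp, rfl⟩ := hF
  obtain ⟨q, hq, rfl⟩ := hG
  have : p - q = 0 := eq_zero_of_forall_ev_sc_eq_zero fun c => by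
    rw [← evLin_apply, map_sub, evLin_apply, evLin_apply, ← hp, ← hq, sub_self]
  rw [sub_eq_zero.mp this]

theorem of_ev (p : ℕ →₀ L) : HasSubst T (fun c => ev (sc c) p) (ev T p) :=
  ⟨p, fun _ => rfl, rfl⟩

theorem const (x : L) : HasSubst T (fun _ => x) x :=
  ⟨Finsupp.single 0 x, by simp [ev], by simp [ev]⟩

theorem add (hF : HasSubst T F v) (hG : HasSubst T G w) :
    HasSubst T (fun c => F c + G c) (v + w) := by
  obtain ⟨p, hp, rfl⟩ := hF
  obtain ⟨q, hq, rfl⟩ := hG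
  refine ⟨p + q, fun c => ?_, ?_⟩ <;>
    simp only [← evLin_apply, map_add, hp, hq]

theorem smul (a : ℂ) (hF : HasSubst T F v) : HasSubst T (fun c => a • F c) (a • v) := by
  obtain ⟨p, hp, rfl⟩ := hF
  refine ⟨a • p, fun c => ?_, ?_⟩ <;>
    simp only [← evLin_apply, map_smul, hp]

theorem sum {ι : Type*} (s : Finset ι) {F : ι → ℂ → L} {v : ι → L}
    (hF : ∀ i, HasSubst T (F i) (v i)) :
    HasSubst T (fun c => ∑ i ∈ s, F i c) (∑ i ∈ s, v i) := by
  classical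
  induction s using Finset.induction_on with
  | empty => simpa using const (T := T) (0 : L)
  | insert i s hi ih => simpa [Finset.sum_insert hi] using (hF i).add ih

theorem var_smul (hF : HasSubst T F v) : HasSubst T (fun c => c • F c) (T v) := by
  obtain ⟨p, hp, rfl⟩ := hF
  have key (S : Module.End ℂ L) : S (ev S p) = ev S (p.mapDomain Nat.succ) := by
    unfold ev
    rw [Finsupp.sum_mapDomain_index (by simp) (by simp), map_finsuppSum]
    simp [pow_succ']
  exact ⟨p.mapDomain Nat.succ, fun c => by rw [← key, ← hp, sc_apply], key T⟩

theorem add_smul (l : ℂ) (hF : HasSubst T F v) :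
    HasSubst T (fun c => (c + l) • F c) ((T + sc l : Module.End ℂ L) v) := by
  simpa [_root_.add_smul, sc_apply] using hF.var_smul.add (hF.smul l)

theorem add_pow_smul (l : ℂ) (n : ℕ) (hF : HasSubst T F v) :
    HasSubst T (fun c => (c + l) ^ n • F c) (((T + sc l) ^ n : Module.End ℂ L) v) := by
  induction n with
  | zero => simpa using hF
  | succ n ih => simpa [pow_succ', mul_smul] using ih.add_smul l

theorem pow_smul (n : ℕ) (hF : HasSubst T F v) :
    HasSubst T (fun c => c ^ n • F c) ((T ^ n) v) := by
  simpa [sc] using hF.add_pow_smul 0 n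

theorem ev_add (l : ℂ) (p : ℕ →₀ L) :
    HasSubst T (fun c => ev (sc (c + l)) p) (ev (T + sc l) p) := by
  simp only [ev, sc_pow_apply]
  exact sum _ fun n => (const (p n)).add_pow_smul l n

theorem map_ev_s1 {f S : Module.End ℂ L} (hf : ∀ x, f (S x) = T (f x)) (p : ℕ →₀ L) :
    HasSubst T (fun c => f (ev (sc c) p)) (f (ev S p)) :=
  ⟨_, fun c => map_ev_sc f c p, ConfFormal.map_ev_s1 hf p⟩

end HasSubst

/-- The operator `y ↦ x ∘_T y`. -/
noncomputable def appRight (m : L →ₗ[ℂ] L →ₗ[ℂ] (ℕ →₀ L)) (T : Module.End ℂ L) (x : L) :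
    Module.End ℂ L := evLin T ∘ₗ m x

/-- The operator `x ↦ x ∘_T y`. -/
noncomputable def appLeft (m : L →ₗ[ℂ] L →ₗ[ℂ] (ℕ →₀ L)) (T : Module.End ℂ L) (y : L) :
    Module.End ℂ L := evLin T ∘ₗ m.flip y

theorem appRight_apply (m : L →ₗ[ℂ] L →ₗ[ℂ] (ℕ →₀ L)) (T : Module.End ℂ L) (x y : L) :
    appRight m T x y = app m T x y := rfl

theorem appLeft_apply (m : L →ₗ[ℂ] L →ₗ[ℂ] (ℕ →₀ L)) (T : Module.End ℂ L) (x y : L) :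
    appLeft m T y x = app m T x y := rfl

theorem HasSubst.app_ev_add {T : Module.End ℂ L} (b : L →ₗ[ℂ] L →ₗ[ℂ] (ℕ →₀ L)) (l : ℂ)
    (p : ℕ →₀ L) (y : L) :
    HasSubst T (fun c => app b (sc (c + l)) (ev (sc c) p) y)
      (ev T (Finsupp.mapRange.linearMap (appLeft b (T + sc l) y) p)) := by
  have h : ev T (Finsupp.mapRange.linearMap (appLeft b (T + sc l) y) p) =
      ∑ n ∈ p.support, (T ^ n) (app b (T + sc l) (p n) y) := by
    unfold ev
    rw [Finsupp.mapRange.linearMap_apply, Finsupp.sum_mapRange_index (by simp)]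
    rfl
  have h' (c : ℂ) : app b (sc (c + l)) (ev (sc c) p) y =
      ∑ n ∈ p.support, c ^ n • app b (sc (c + l)) (p n) y := by
    rw [← appLeft_apply]
    simp [ev, Finsupp.sum, sc_pow_apply, appLeft_apply]
  simp only [h, h']
  exact HasSubst.sum _ fun n => (HasSubst.ev_add l (b (p n) y)).pow_smul n

theorem IsTPCA.two_smul_app_bracket_left {D : Module.End ℂ L}
    {m br : L →ₗ[ℂ] L →ₗ[ℂ] (ℕ →₀ L)} (h : IsTPCA D m br) (x y z : L) (l u : ℂ) :
    (2 : ℂ) • app m (sc u) (app br (sc l) x y) z =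
      app br (sc l) x (app m (sc (u - l)) y z) -
        app br (sc (u - l)) y (app m (sc l) x z) := by
  set T : Module.End ℂ L := -(D + sc u) with hT
  have inter (v a : L) (s : ℂ) :
      appRight br (sc s) v ((-(D + sc (u - s)) : Module.End ℂ L) a) = T (appRight br (sc s) v a) := by
    simp only [hT, LinearMap.neg_apply, LinearMap.add_apply, sc_apply, map_neg, map_add, map_smul,
      appRight_apply, h.lie.sesq_right]
    module
  have hs : T + sc l = -(sc (u - l) + D) := by
    simp only [hT, sc]
    module
  have hmap : appLeft br (T + sc l) y = -appRight br (sc (u - l)) y := by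
    ext a
    rw [LinearMap.neg_apply, appRight_apply, h.lie.skew, hs, neg_neg, appLeft_apply]
  have hfirst : ev T (Finsupp.mapRange.linearMap (appLeft br (T + sc l) y) (m z x)) =
      -app br (sc (u - l)) y (app m (sc l) x z) := by
    have hi := fun a => inter y a (u - l)
    rw [sub_sub_cancel] at hi
    rw [hmap, h.commAssoc.comm x z, ← appRight_apply, app, ← LinearMap.neg_apply]
    exact (map_ev_s1 (fun a => by
      rw [LinearMap.neg_apply (appRight _ _ _), hi, LinearMap.neg_apply (appRight _ _ _), map_neg]) _).symm
  have hsubst := (HasSubst.app_ev_add (T := T) br l (m z x) y).add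
    (HasSubst.map_ev_s1 (fun a => inter x a l) (m z y))
  have hL := (HasSubst.of_ev (T := T) (m z (app br (sc l) x y))).smul 2
  have heq := hL.unique (by
    convert hsubst using 2 with c
    exact h.tLeibniz z x y c l)
  rw [h.commAssoc.comm _ z u, h.commAssoc.comm y z (u - l)]
  rw [hfirst] at heq
  rw [app, heq, appRight_apply, neg_add_eq_sub]
  rfl

theorem IsTPCA.bracket_app_comm {D : Module.End ℂ L}
    {m br : L →ₗ[ℂ] L →ₗ[ℂ] (ℕ →₀ L)} (h : IsTPCA D m br) (x y z : L) (l u : ℂ) :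
    app br (sc u) (app m (sc (u - l)) y x) z = app br (sc u) (app m (sc l) x y) z := by
  rw [h.commAssoc.comm y x, ← appLeft_apply br, ← appLeft_apply br, app, app, map_ev_sc]
  refine map_ev_s1 (fun a => ?_) _
  simp only [LinearMap.neg_apply, LinearMap.add_apply, sc_apply, map_neg, map_add, map_smul,
    appLeft_apply, h.lie.sesq_left]
  module

/-- In a transposed Poisson conformal algebra,
`[x_λ y]∘_μ z + [y_{μ−λ} z]∘_{−∂−λ} x + [z_{−∂−λ} x]∘_{−∂−μ+λ} y = 0`. -/
theorem tpca_identity_eqw {L : Type*} [AddCommGroup L] [Module ℂ L]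
    (D : Module.End ℂ L) (m br : L →ₗ[ℂ] L →ₗ[ℂ] (ℕ →₀ L))
    (h : IsTPCA D m br) :
    ∀ (x y z : L) (l u : ℂ),
      app m (sc u) (app br (sc l) x y) z
        + app m (-(D + sc l)) (app br (sc (u - l)) y z) x
        + app m (-(D + sc (u - l))) (app br (-(D + sc l)) z x) y = 0 := by
  intro x y z l u
  have h₁ := h.two_smul_app_bracket_left x y z l u
  have h₂ := h.tLeibniz x y z l (u - l)
  have h₃ := h.tLeibniz y x z (u - l) l
  rw [add_sub_cancel] at h₂
  rw [sub_add_cancel, h.bracket_app_comm] at h₃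
  have hskew : app br (-(D + sc l)) z x = -app br (sc l) x z := by
    rw [h.lie.skew x z, neg_neg, add_comm]
  rw [← h.commAssoc.comm x, ← h.commAssoc.comm y, hskew, ← appRight_apply m _ y, map_neg,
    appRight_apply]
  refine (smul_eq_zero_iff_right (two_ne_zero (α := ℂ))).mp ?_
  rw [smul_add, smul_add, smul_neg, h₁, h₂, h₃]
  abel

end ConfFormal
end

section
/- Let (L, ∘_λ, [·_λ·]) be a transposed Poisson conformal algebra. Then for all x, y, z, h ∈ L the identity [(h∘_λ[x_γ y])_{λ+μ} z] + [(h∘_λ[y_{μ−γ} z])_{−∂−γ} x] + [(h∘_λ[z_{−∂−γ} x])_{−∂−μ+γ} y] = 0 holds (as an identity of polynomials in λ, μ, γ with coefficients in L, where substitutions of the λ-variable by expressions involving ∂ are interpreted via the ℂ[∂]-module action). -/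
/-!
We model a `ℂ[∂]`-module as a complex vector space `L` together with an
endomorphism `D` (the action of `∂`).  A `λ`-product (or `λ`-bracket) is a
`ℂ`-bilinear map `L → L → L[λ]`, where the polynomial `x ∘_λ y = Σₙ λⁿ • cₙ`
is encoded by its finitely supported family of coefficients `ℕ →₀ L`.
Substitution of the variable `λ` by a complex scalar, or by an operator such
as `-∂-λ`, is given by `ev`; since `ℂ` is infinite, an identity of
polynomials in (several) variables `λ, μ, γ` with coefficients in a complex
vector space holds formally if and only if it holds for all complex values
of the variables, which is how all identities are stated below.
-/

namespace ConfFormal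

variable {L : Type*} [AddCommGroup L] [Module ℂ L]

theorem ev_add (T : Module.End ℂ L) (p q : ℕ →₀ L) : ev T (p + q) = ev T p + ev T q :=
  Finsupp.sum_add_index' (fun _ => map_zero _) fun _ => map_add _

theorem ev_smul (T : Module.End ℂ L) (c : ℂ) (p : ℕ →₀ L) : ev T (c • p) = c • ev T p := by
  simp only [ev, Finsupp.smul_sum]
  rw [Finsupp.sum_smul_index' fun _ => map_zero _]
  simp only [map_smul]

theorem app_add_left (m : L →ₗ[ℂ] L →ₗ[ℂ] (ℕ →₀ L)) (T : Module.End ℂ L) (x x' y : L) :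
    app m T (x + x') y = app m T x y + app m T x' y := by
  simp [app, ev_add]

theorem app_add_right (m : L →ₗ[ℂ] L →ₗ[ℂ] (ℕ →₀ L)) (T : Module.End ℂ L) (x y y' : L) :
    app m T x (y + y') = app m T x y + app m T x y' := by
  simp [app, ev_add]

theorem app_smul_left (m : L →ₗ[ℂ] L →ₗ[ℂ] (ℕ →₀ L)) (T : Module.End ℂ L) (c : ℂ) (x y : L) :
    app m T (c • x) y = c • app m T x y := by
  simp [app, ev_smul]

theorem app_smul_right (m : L →ₗ[ℂ] L →ₗ[ℂ] (ℕ →₀ L)) (T : Module.End ℂ L) (c : ℂ) (x y : L) :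
    app m T x (c • y) = c • app m T x y := by
  simp [app, ev_smul]

theorem app_neg_right (m : L →ₗ[ℂ] L →ₗ[ℂ] (ℕ →₀ L)) (T : Module.End ℂ L) (x y : L) :
    app m T x (-y) = -app m T x y := by
  simpa using app_smul_right m T (-1) x y

theorem IsLieConfAlg.app_neg_add {D : Module.End ℂ L} {br : L →ₗ[ℂ] L →ₗ[ℂ] (ℕ →₀ L)}
    (hL : IsLieConfAlg D br) (x y : L) (l : ℂ) :
    app br (-(D + sc l)) y x = -app br (sc l) x y := by
  rw [hL.skew x y l, neg_neg, add_comm]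

/-- The identity `tpca_identity_eqs` with every product evaluated at a scalar. -/
theorem IsTPCA.scalar_identity {D : Module.End ℂ L} {m br : L →ₗ[ℂ] L →ₗ[ℂ] (ℕ →₀ L)}
    (hT : IsTPCA D m br) (x y z h : L) (l g v : ℂ) :
    app br (sc (l + (g + v))) (app m (sc l) h (app br (sc g) x y)) z
      - app br (sc g) x (app m (sc l) h (app br (sc v) y z))
      + app br (sc v) y (app m (sc l) h (app br (sc g) x z)) = 0 := by
  have two_left (a b c : L) (s t : ℂ) := congrArg (app br (sc t) · c) (hT.tLeibniz h a b l s)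
  have two_right (a b c : L) (s t : ℂ) := congrArg (app br (sc t) c ·) (hT.tLeibniz h a b l s)
  simp only [app_smul_left, app_smul_right, app_add_left, app_add_right] at two_left two_right
  have jacobi_h := congrArg (fun w => (2 : ℂ) • app m (sc l) h w) (hT.lie.jacobi x y z g v)
  simp only [app_add_right, smul_add, hT.tLeibniz] at jacobi_h
  have jacobi_x := hT.lie.jacobi (app m (sc l) h x) y z (l + g) v
  have jacobi_y := hT.lie.jacobi x (app m (sc l) h y) z g (l + v)
  have jacobi_z := hT.lie.jacobi x y (app m (sc l) h z) g v
  rw [add_assoc] at jacobi_x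
  rw [add_left_comm] at jacobi_y
  linear_combination (norm := module) two_left x y z g (l + (g + v)) - two_right y z x v g
    + two_right x z y g v + jacobi_h - jacobi_x - jacobi_y - jacobi_z

/-- In a transposed Poisson conformal algebra,
`[(h∘_λ[x_γ y])_{λ+μ} z] + [(h∘_λ[y_{μ−γ} z])_{−∂−γ} x]
  + [(h∘_λ[z_{−∂−γ} x])_{−∂−μ+γ} y] = 0`. -/
theorem tpca_identity_eqs {L : Type*} [AddCommGroup L] [Module ℂ L]
    (D : Module.End ℂ L) (m br : L →ₗ[ℂ] L →ₗ[ℂ] (ℕ →₀ L))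
    (hT : IsTPCA D m br) :
    ∀ (x y z h : L) (l u g : ℂ),
      app br (sc (l + u)) (app m (sc l) h (app br (sc g) x y)) z
        + app br (-(D + sc g)) (app m (sc l) h (app br (sc (u - g)) y z)) x
        + app br (-(D + sc (u - g))) (app m (sc l) h (app br (-(D + sc g)) z x)) y = 0 := by
  intro x y z h l u g
  have key := hT.scalar_identity x y z h l g (u - g)
  rw [add_sub_cancel] at key
  simp only [hT.lie.app_neg_add, app_neg_right, neg_neg]
  rwa [← sub_eq_add_neg]

end ConfFormal
end
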